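/- Let N ≥ 2 and 1 ≤ k ≤ N−1. The partial trace over the last k qubits of the density matrix of the N-qubit W state satisfies Tr_k |W_N⟩⟨W_N| = ((N−k)/N)·|W_{N−k}⟩⟨W_{N−k}| + (k/N)·|0…0⟩⟨0…0|, where |W_{N−k}⟩⟨W_{N−k}| is the density matrix of the (N−k)-qubit W state and |0…0⟩⟨0…0| is the rank-one matrix whose only nonzero entry is 1 at the all-zero string of N−k qubits. -/

import Mathlib

open Finset

/-- The m-qubit W state: amplitude `1/√m` on strings with exactly one coordinate
equal to 1, and 0 otherwise. -/
noncomputable def Wstate (m : ℕ) (x : Fin m → Fin 2) : ℂ :=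
  if (∑ i, (x i : ℕ)) = 1 then ((1 / Real.sqrt m : ℝ) : ℂ) else 0

/-- The N-qubit W state, with the index set (Fin N → Fin 2) identified with
((Fin (N−k) → Fin 2) × (Fin k → Fin 2)): amplitude `1/√N` on pairs with exactly
one coordinate (in total) equal to 1. -/
noncomputable def WstateSplit (N m k : ℕ)
    (p : (Fin m → Fin 2) × (Fin k → Fin 2)) : ℂ :=
  if (∑ i, (p.1 i : ℕ)) + (∑ j, (p.2 j : ℕ)) = 1 then ((1 / Real.sqrt N : ℝ) : ℂ) else 0

theorem sum_val_eq_zero_iff {m : ℕ} (x : Fin m → Fin 2) : (∑ i, (x i : ℕ)) = 0 ↔ x = 0 := by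
  simp only [Finset.sum_eq_zero_iff, mem_univ, true_imp_iff, funext_iff, Fin.ext_iff, Pi.zero_apply,
    Fin.val_zero]

theorem sum_val_eq_one_iff {m : ℕ} (x : Fin m → Fin 2) :
    (∑ i, (x i : ℕ)) = 1 ↔ ∃ i, Pi.single i 1 = x := by
  constructor
  · intro h
    obtain ⟨i, -, hi⟩ : ∃ i ∈ univ, (x i : ℕ) ≠ 0 :=
      Finset.exists_ne_zero_of_sum_ne_zero (by omega)
    refine ⟨i, funext fun j => ?_⟩
    have hsum := Finset.add_sum_erase univ (fun i => (x i : ℕ)) (mem_univ i)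
    have hrest : ∑ j ∈ univ.erase i, (x j : ℕ) = 0 := by
      omega
    rcases eq_or_ne j i with rfl | hj
    · simp only [Pi.single_eq_same, Fin.ext_iff, Fin.val_one]
      omega
    · have := Finset.sum_eq_zero_iff.mp hrest j (by simp [hj])
      simp [Pi.single_eq_of_ne hj, Fin.ext_iff, this]
  · rintro ⟨i, rfl⟩
    rw [Finset.sum_eq_single i] <;> simp +contextual [Pi.single_eq_of_ne]

theorem card_sum_val_eq_one (k : ℕ) :
    #{c : Fin k → Fin 2 | (∑ i, (c i : ℕ)) = 1} = k := by
  have h : ({c : Fin k → Fin 2 | (∑ i, (c i : ℕ)) = 1} : Finset _) =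
      univ.image fun i => Pi.single i 1 := by
    ext c
    simp [sum_val_eq_one_iff]
  rw [h, Finset.card_image_of_injective, card_univ, Fintype.card_fin]
  intro i j hij
  by_contra hne
  have := congrFun hij i
  simp [Pi.single_eq_of_ne hne] at this

theorem card_sum_val_eq_zero (k : ℕ) :
    #{c : Fin k → Fin 2 | (∑ i, (c i : ℕ)) = 0} = 1 := by
  simp_rw [sum_val_eq_zero_iff]
  simp [Finset.filter_eq']

theorem one_div_sqrt_mul_conj (m : ℕ) :
    ((1 / Real.sqrt m : ℝ) : ℂ) * (starRingEnd ℂ) ((1 / Real.sqrt m : ℝ) : ℂ) = 1 / m := by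
  rw [Complex.conj_ofReal, ← Complex.ofReal_mul, div_mul_div_comm,
    Real.mul_self_sqrt (Nat.cast_nonneg m)]
  simp

theorem Wstate_mul_conj (m : ℕ) (a b : Fin m → Fin 2) :
    Wstate m a * (starRingEnd ℂ) (Wstate m b) =
      if (∑ i, (a i : ℕ)) = 1 ∧ (∑ i, (b i : ℕ)) = 1 then 1 / (m : ℂ) else 0 := by
  unfold Wstate
  rw [← one_div_sqrt_mul_conj]
  split_ifs <;> simp_all

theorem sum_WstateSplit_mul_conj (N m k : ℕ) (a b : Fin m → Fin 2) :
    ∑ c : Fin k → Fin 2, WstateSplit N m k (a, c) * (starRingEnd ℂ) (WstateSplit N m k (b, c)) =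
      #{c : Fin k → Fin 2 | (∑ i, (a i : ℕ)) + (∑ j, (c j : ℕ)) = 1 ∧
        (∑ i, (b i : ℕ)) + (∑ j, (c j : ℕ)) = 1} * (1 / (N : ℂ)) := by
  rw [← nsmul_eq_mul, ← Finset.sum_const, Finset.sum_filter]
  refine Finset.sum_congr rfl fun c _ => ?_
  unfold WstateSplit
  rw [← one_div_sqrt_mul_conj]
  split_ifs <;> simp_all

/-- Tr_k |W_N⟩⟨W_N| = ((N−k)/N)·|W_{N−k}⟩⟨W_{N−k}| + (k/N)·|0…0⟩⟨0…0| :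
the partial trace of the N-qubit W state over the last k qubits. -/
theorem W_partial_trace (N k : ℕ) (hN : 2 ≤ N) (hk : 1 ≤ k) (hkN : k ≤ N - 1) :
    (fun a b : Fin (N - k) → Fin 2 =>
        ∑ c : Fin k → Fin 2,
          WstateSplit N (N - k) k (a, c) * (starRingEnd ℂ) (WstateSplit N (N - k) k (b, c)))
      = fun a b : Fin (N - k) → Fin 2 =>
          (((N - k : ℕ) : ℂ) / N) * (Wstate (N - k) a * (starRingEnd ℂ) (Wstate (N - k) b))
            + ((k : ℂ) / N) * (if a = 0 ∧ b = 0 then 1 else 0) := by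
  funext a b
  have hm : ((N - k : ℕ) : ℂ) ≠ 0 := Nat.cast_ne_zero.mpr (by omega)
  rw [sum_WstateSplit_mul_conj, Wstate_mul_conj]
  simp only [← sum_val_eq_zero_iff]
  generalize (∑ i, (a i : ℕ)) = s
  generalize (∑ i, (b i : ℕ)) = t
  by_cases hst : s = t
  · subst hst
    simp only [and_self]
    rcases s with _ | _ | s
    · simp [card_sum_val_eq_one, div_eq_mul_inv]
    · have h (n : ℕ) : 0 + 1 + n = 1 ↔ n = 0 := by omega
      simp only [h, card_sum_val_eq_zero]
      simp
      field_simp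
    · have h (n : ℕ) : ¬ s + 1 + 1 + n = 1 := by omega
      simp [h]
  · have h (n : ℕ) : ¬ (s + n = 1 ∧ t + n = 1) := by omega
    have h1 : ¬ (s = 1 ∧ t = 1) := by omega
    have h0 : ¬ (s = 0 ∧ t = 0) := by omega
    simp [h, h1, h0]
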